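/- For every k ≥ 2, the sphere S^{2k} cannot be covered by 2k+2 open sets, none containing a pair of antipodal points, such that every point of the sphere is contained in at most k+2 of the sets. -/

import Mathlib

/-- A real polynomial of odd degree has a real root. -/
theorem Polynomial.exists_isRoot_of_odd_natDegree_real {p : Polynomial ℝ} (hp : p.Monic)
    (hodd : Odd p.natDegree) : ∃ x, p.IsRoot x := by
  by_contra! h
  have hlc : 0 ≤ p.leadingCoeff := by simp [hp.leadingCoeff]
  have h1 := Polynomial.zero_lt_eval_of_roots_lt_of_leadingCoeff_nonneg (x := 0)
    (fun y hy => absurd hy (h y)) hlc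
  have h2 := Polynomial.zero_lt_negOnePow_mul_eval_of_lt_roots_of_leadingCoeff_nonneg (x := 0)
    (fun y hy => absurd hy (h y)) hlc
  rw [Int.negOnePow_odd _ (by exact_mod_cast hodd)] at h2
  push_cast at h2
  linarith

open Module in
/-- A commutative real algebra of odd dimension has a real point. -/
theorem nonempty_algHom_real_of_odd_finrank {A : Type*} [CommRing A] [Algebra ℝ A]
    (hA : Odd (finrank ℝ A)) : Nonempty (A →ₐ[ℝ] ℝ) := by
  induction h : finrank ℝ A using Nat.strong_induction_on generalizing A with
  | _ n ih =>
  subst h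
  have hfin : Module.Finite ℝ A := Module.finite_of_finrank_pos hA.pos
  by_cases hsurj : Function.Surjective (algebraMap ℝ A)
  · have : Nontrivial A := Module.nontrivial_of_finrank_pos (R := ℝ) hA.pos
    let e : ℝ ≃ₐ[ℝ] A := AlgEquiv.ofBijective (Algebra.ofId ℝ A)
      ⟨(algebraMap ℝ A).injective, hsurj⟩
    exact ⟨e.symm.toAlgHom⟩
  · obtain ⟨a, ha⟩ := not_forall.mp hsurj
    obtain ⟨r, hr⟩ := Polynomial.exists_isRoot_of_odd_natDegree_real
      (LinearMap.charpoly_monic (LinearMap.mulLeft ℝ a))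
      (by rwa [LinearMap.charpoly_natDegree])
    rw [← Module.End.hasEigenvalue_iff_isRoot_charpoly] at hr
    obtain ⟨v, hv⟩ := hr.exists_hasEigenvector
    have hva : a * v = r • v := hv.apply_eq_smul
    let f : A →ₗ[A] A := LinearMap.toSpanSingleton A A (a - algebraMap ℝ A r)
    have hf : ∀ x, f x = x * (a - algebraMap ℝ A r) := fun x => rfl
    have hsum := (f.restrictScalars ℝ).finrank_range_add_finrank_ker
    have hker : finrank ℝ (LinearMap.ker (f.restrictScalars ℝ)) ≠ 0 := by
      rw [Ne, Submodule.finrank_eq_zero, Submodule.eq_bot_iff]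
      intro h
      refine hv.2 (h v ?_)
      rw [LinearMap.mem_ker, LinearMap.restrictScalars_apply, hf, mul_sub, mul_comm, hva,
        Algebra.smul_def, mul_comm, sub_self]
    have hrange : finrank ℝ (LinearMap.range (f.restrictScalars ℝ)) ≠ 0 := by
      rw [Ne, Submodule.finrank_eq_zero, Submodule.eq_bot_iff]
      intro h
      refine ha ⟨r, ?_⟩
      have := h (f 1) ⟨1, rfl⟩
      rw [hf, one_mul, sub_eq_zero] at this
      exact this.symm
    have hq1 := Submodule.finrank_quotient (R := ℝ) (LinearMap.ker f)
    have hq2 := Submodule.finrank_quotient (R := ℝ) (LinearMap.range f)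
    have e1 : finrank ℝ (LinearMap.ker f) = finrank ℝ (LinearMap.ker (f.restrictScalars ℝ)) := rfl
    have e2 : finrank ℝ (LinearMap.range f) =
      finrank ℝ (LinearMap.range (f.restrictScalars ℝ)) := rfl
    rw [e1] at hq1
    rw [e2] at hq2
    rcases Nat.even_or_odd (finrank ℝ (LinearMap.ker (f.restrictScalars ℝ))) with hev | hod
    · obtain ⟨φ⟩ := ih (finrank ℝ (A ⧸ LinearMap.ker f)) (by omega)
        (by rw [hq1]; grind) rfl
      exact ⟨φ.comp (Ideal.Quotient.mkₐ ℝ (LinearMap.ker f))⟩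
    · obtain ⟨φ⟩ := ih (finrank ℝ (A ⧸ LinearMap.range f)) (by omega)
        (by rw [hq2]; grind) rfl
      exact ⟨φ.comp (Ideal.Quotient.mkₐ ℝ (LinearMap.range f))⟩

section Division

open MvPolynomial

variable {n : ℕ} {R : Type*} [CommRing R]

/-- The monomial `X ^ c` with each factor `X i ^ D` replaced by `F i`. -/
noncomputable def twistedMonomial (D : ℕ) (F : Fin n → MvPolynomial (Fin n) R) (c : Fin n →₀ ℕ) :
    MvPolynomial (Fin n) R :=
  monomial (c.mapRange (· % D) (Nat.zero_mod D)) 1 * ∏ i, F i ^ (c i / D)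

/-- The linear endomorphism of the polynomial ring sending `X ^ c` to `twistedMonomial D F c`. -/
noncomputable def twist (D : ℕ) (F : Fin n → MvPolynomial (Fin n) R) :
    MvPolynomial (Fin n) R →ₗ[R] MvPolynomial (Fin n) R :=
  (basisMonomials (Fin n) R).constr R (twistedMonomial D F)

theorem twist_monomial (D : ℕ) (F : Fin n → MvPolynomial (Fin n) R) (c : Fin n →₀ ℕ) (a : R) :
    twist D F (monomial c a) = a • twistedMonomial D F c := by
  have h := (basisMonomials (Fin n) R).constr_basis R (twistedMonomial D F) c
  rw [coe_basisMonomials] at h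
  rw [← h, ← map_smul, smul_monomial, smul_eq_mul, mul_one]
  rfl

theorem mul_twistedMonomial {D : ℕ} (hD : 0 < D) (F : Fin n → MvPolynomial (Fin n) R)
    (c : Fin n →₀ ℕ) (i : Fin n) :
    F i * twistedMonomial D F c = twistedMonomial D F (c + Finsupp.single i D) := by
  have h1 : (c + Finsupp.single i D).mapRange (· % D) (Nat.zero_mod D) =
      c.mapRange (· % D) (Nat.zero_mod D) := by
    ext j
    rcases eq_or_ne i j with rfl | hij <;> simp [*]
  have h2 : ∀ j, (c + Finsupp.single i D) j / D = c j / D + if j = i then 1 else 0 := by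
    intro j
    rcases eq_or_ne j i with rfl | hij
    · simp [hD]
    · simp [hij]
  simp only [twistedMonomial, h1, h2, pow_add, Finset.prod_mul_distrib]
  simp [Finset.prod_ite_eq']
  ring

theorem dvd_twistedMonomial {D : ℕ} (hD : 0 < D) (F : Fin n → MvPolynomial (Fin n) R)
    {c : Fin n →₀ ℕ} {i : Fin n} (hi : D ≤ c i) : F i ∣ twistedMonomial D F c := by
  refine ⟨twistedMonomial D F (c - Finsupp.single i D), ?_⟩
  rw [mul_twistedMonomial hD, tsub_add_cancel_of_le (by simpa using hi)]

theorem totalDegree_twistedMonomial_le {D : ℕ} {F : Fin n → MvPolynomial (Fin n) R}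
    (hF : ∀ i, (F i).totalDegree ≤ D) (c : Fin n →₀ ℕ) :
    (twistedMonomial D F c).totalDegree ≤ c.degree := by
  refine (totalDegree_mul _ _).trans ?_
  have h1 := totalDegree_monomial_le (c.mapRange (· % D) (Nat.zero_mod D)) (1 : R)
  have h2 : (∏ i, F i ^ (c i / D)).totalDegree ≤ ∑ i, (c i / D) * D := by
    refine (totalDegree_finsetProd _ _).trans (Finset.sum_le_sum fun i _ => ?_)
    exact (totalDegree_pow _ _).trans (Nat.mul_le_mul_left _ (hF i))
  rw [Finsupp.sum_fintype _ _ (by simp)] at h1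
  refine (add_le_add h1 h2).trans ?_
  rw [Finsupp.degree_eq_sum, ← Finset.sum_add_distrib]
  refine Finset.sum_le_sum fun i _ => ?_
  simpa using (Nat.mod_add_div' (c i) D).le

theorem map_twistedMonomial {S : Type*} [CommRing S] (φ : R →+* S) (D : ℕ)
    (F : Fin n → MvPolynomial (Fin n) R) (c : Fin n →₀ ℕ) :
    map φ (twistedMonomial D F c) = twistedMonomial D (fun i => map φ (F i)) c := by
  simp [twistedMonomial]

theorem twistedMonomial_X_pow (D : ℕ) (c : Fin n →₀ ℕ) :
    twistedMonomial D (fun i => (X i : MvPolynomial (Fin n) R) ^ D) c = monomial c 1 := by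
  have : (∏ i, ((X i : MvPolynomial (Fin n) R) ^ D) ^ (c i / D)) =
      monomial (Finsupp.equivFunOnFinite.symm fun i => D * (c i / D)) 1 := by
    rw [monomial_eq, Finsupp.prod_fintype _ _ (by simp)]
    simp [pow_mul]
  rw [twistedMonomial, this, monomial_mul, one_mul]
  congr 2
  ext i
  exact Nat.mod_add_div (c i) D

instance (m : ℕ) : Finite {c : Fin n →₀ ℕ // c.degree ≤ m} :=
  (Finsupp.finite_of_degree_le m).to_subtype

noncomputable instance (m : ℕ) : Fintype {c : Fin n →₀ ℕ // c.degree ≤ m} :=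
  Fintype.ofFinite _

/-- The matrix of `twist D F` on polynomials of degree at most `m`. -/
noncomputable def twistMatrix (D : ℕ) (F : Fin n → MvPolynomial (Fin n) R) (m : ℕ) :
    Matrix {c : Fin n →₀ ℕ // c.degree ≤ m} {c : Fin n →₀ ℕ // c.degree ≤ m} R :=
  fun c c' => coeff c (twistedMonomial D F c')

theorem sum_monomial_coeff_of_totalDegree_le {m : ℕ} {p : MvPolynomial (Fin n) R}
    (hp : p.totalDegree ≤ m) :
    ∑ c : {c : Fin n →₀ ℕ // c.degree ≤ m}, monomial (c : Fin n →₀ ℕ) (coeff c p) = p := by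
  ext e
  simp only [coeff_sum, coeff_monomial]
  by_cases he : e.degree ≤ m
  · rw [Finset.sum_eq_single ⟨e, he⟩] <;> simp +contextual [Subtype.ext_iff]
  · rw [coeff_eq_zero_of_totalDegree_lt (f := p) (by
      rw [Finsupp.degree_apply] at he; omega)]
    refine Finset.sum_eq_zero fun c _ => if_neg ?_
    rintro rfl
    exact he c.2

theorem coeff_twist_sum_monomial (D : ℕ) (F : Fin n → MvPolynomial (Fin n) R) {m : ℕ}
    (v : {c : Fin n →₀ ℕ // c.degree ≤ m} → R) (e : {c : Fin n →₀ ℕ // c.degree ≤ m}) :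
    coeff (e : Fin n →₀ ℕ) (twist D F (∑ c, monomial c.1 (v c))) =
      (twistMatrix D F m).mulVec v e := by
  simp [twist_monomial, coeff_sum, Matrix.mulVec, dotProduct, twistMatrix, mul_comm]

theorem totalDegree_twist_sum_monomial_le {D : ℕ} {F : Fin n → MvPolynomial (Fin n) R}
    (hF : ∀ i, (F i).totalDegree ≤ D) {m : ℕ} (v : {c : Fin n →₀ ℕ // c.degree ≤ m} → R) :
    (twist D F (∑ c, monomial c.1 (v c))).totalDegree ≤ m := by
  rw [map_sum]
  refine totalDegree_finsetSum_le fun c _ => ?_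
  rw [twist_monomial]
  exact (totalDegree_smul_le _ _).trans ((totalDegree_twistedMonomial_le hF _).trans c.2)

theorem twist_bijective {K : Type*} [Field K] {D : ℕ} {F : Fin n → MvPolynomial (Fin n) K}
    (hF : ∀ i, (F i).totalDegree ≤ D) (hdet : ∀ m, (twistMatrix D F m).det ≠ 0) :
    Function.Bijective (twist D F) := by
  constructor
  · rw [← LinearMap.ker_eq_bot, LinearMap.ker_eq_bot']
    intro p hp
    have hsum := sum_monomial_coeff_of_totalDegree_le (le_refl p.totalDegree)
    have hv := Matrix.eq_zero_of_mulVec_eq_zero (hdet p.totalDegree)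
      (v := fun c => coeff (c : Fin n →₀ ℕ) p) (by
        ext e
        rw [← coeff_twist_sum_monomial, hsum, hp]
        simp)
    rw [← hsum]
    refine Finset.sum_eq_zero fun c _ => ?_
    rw [show coeff (c : Fin n →₀ ℕ) p = 0 from congrFun hv c, monomial_zero]
  · intro q
    set m := q.totalDegree with hm
    let v := (twistMatrix D F m)⁻¹.mulVec fun c => coeff (c : Fin n →₀ ℕ) q
    refine ⟨∑ c, monomial c.1 (v c), ?_⟩
    rw [← sum_monomial_coeff_of_totalDegree_le (totalDegree_twist_sum_monomial_le hF v),
      ← sum_monomial_coeff_of_totalDegree_le hm.ge]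
    refine Finset.sum_congr rfl fun c _ => ?_
    rw [coeff_twist_sum_monomial, Matrix.mulVec_mulVec,
      Matrix.mul_nonsing_inv _ (isUnit_iff_ne_zero.mpr (hdet m)), Matrix.one_mulVec]

/-- If `twist D F` is bijective, then the quotient by `F` has dimension `D ^ n`. -/
theorem finrank_quotient_of_twist_bijective {K : Type*} [Field K] {D : ℕ} (hD : 0 < D)
    {F : Fin n → MvPolynomial (Fin n) K} (hbij : Function.Bijective (twist D F)) :
    Module.finrank K (MvPolynomial (Fin n) K ⧸ Ideal.span (Set.range F)) = D ^ n := by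
  let Φ : MvPolynomial (Fin n) K ≃ₗ[K] MvPolynomial (Fin n) K :=
    LinearEquiv.ofBijective (twist D F) hbij
  have hΦ : ∀ p, Φ p = twist D F p := fun _ => rfl
  let box : (Fin n → Fin D) → (Fin n →₀ ℕ) := fun b =>
    Finsupp.equivFunOnFinite.symm fun i => (b i : ℕ)
  have hbox : Function.Injective box := by
    intro b b' h
    ext i
    exact DFunLike.congr_fun h i
  let ρ : MvPolynomial (Fin n) K →ₗ[K] ((Fin n → Fin D) → K) :=
    LinearMap.pi fun b => lcoeff K (box b)
  have hρ : ∀ p b, ρ p b = coeff (box b) p := fun _ _ => rfl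
  have hρsurj : Function.Surjective ρ := by
    intro w
    refine ⟨∑ b, monomial (box b) (w b), ?_⟩
    ext b
    rw [hρ, coeff_sum, Finset.sum_eq_single b]
    · simp
    · intro b' _ hb'
      rw [coeff_monomial, if_neg (hbox.ne hb')]
    · simp
  have hρmon : ∀ (c : Fin n →₀ ℕ) (a : K) (i : Fin n), D ≤ c i → ρ (monomial c a) = 0 := by
    intro c a i hi
    ext b
    rw [hρ, coeff_monomial, if_neg]
    · rfl
    · rintro rfl
      exact absurd (b i).2 (not_lt.mpr hi)
  let ψ : MvPolynomial (Fin n) K →ₗ[K] ((Fin n → Fin D) → K) := ρ ∘ₗ Φ.symm.toLinearMap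
  have hψ : ∀ p, ψ p = ρ (Φ.symm p) := fun _ => rfl
  have hψsurj : Function.Surjective ψ := hρsurj.comp Φ.symm.surjective
  have hmul : ∀ i p, ψ (F i * twist D F p) = 0 := by
    intro i p
    induction p using MvPolynomial.induction_on' with
    | monomial c a =>
      rw [twist_monomial, mul_smul_comm, mul_twistedMonomial hD, ← twist_monomial, ← hΦ, hψ,
        LinearEquiv.symm_apply_apply]
      exact hρmon _ _ i (by simp)
    | add p q hp hq => rw [map_add, mul_add, map_add, hp, hq, add_zero]
  have hker : LinearMap.ker ψ = (Ideal.span (Set.range F)).restrictScalars K := by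
    apply le_antisymm
    · intro p hp
      obtain ⟨q, rfl⟩ := Φ.surjective p
      rw [LinearMap.mem_ker, hψ, LinearEquiv.symm_apply_apply] at hp
      rw [Submodule.restrictScalars_mem, hΦ, q.as_sum, map_sum]
      refine Submodule.sum_mem _ fun c hc => ?_
      rw [twist_monomial]
      have : ∃ i, D ≤ c i := by
        by_contra! h
        have h0 : coeff (box fun i => ⟨c i, h i⟩) q = 0 := congrFun hp fun i => ⟨c i, h i⟩
        have hc' : box (fun i => ⟨c i, h i⟩) = c := by
          ext i
          rfl
        exact (mem_support_iff.mp hc) (hc' ▸ h0)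
      obtain ⟨i, hi⟩ := this
      refine Submodule.smul_of_tower_mem _ _ ?_
      exact Ideal.mem_of_dvd _ (dvd_twistedMonomial hD F hi) (Ideal.subset_span ⟨i, rfl⟩)
    · intro p hp
      rw [Submodule.restrictScalars_mem] at hp
      rw [LinearMap.mem_ker]
      obtain ⟨c, rfl⟩ := Ideal.mem_span_range_iff_exists_fun.mp hp
      rw [map_sum]
      refine Finset.sum_eq_zero fun i _ => ?_
      obtain ⟨q, hq⟩ := hbij.surjective (c i)
      rw [← hq, mul_comm, hmul]
  have e : (MvPolynomial (Fin n) K ⧸ Ideal.span (Set.range F)) ≃ₗ[K] ((Fin n → Fin D) → K) :=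
    (Submodule.Quotient.restrictScalarsEquiv K _).symm ≪≫ₗ
      Submodule.quotEquivOfEq _ _ hker.symm ≪≫ₗ ψ.quotKerEquivOfSurjective hψsurj
  rw [e.finrank_eq]
  simp

theorem det_twistMatrix_map {S : Type*} [CommRing S] (φ : R →+* S) (D : ℕ)
    (F : Fin n → MvPolynomial (Fin n) R) (m : ℕ) :
    (twistMatrix D (fun i => map φ (F i)) m).det = φ (twistMatrix D F m).det := by
  rw [RingHom.map_det]
  congr 1
  ext c c'
  simp [twistMatrix, ← map_twistedMonomial, coeff_map]

theorem det_twistMatrix_X_pow (D m : ℕ) :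
    (twistMatrix D (fun i => (X i : MvPolynomial (Fin n) R) ^ D) m).det = 1 := by
  rw [← Matrix.det_one (n := {c : Fin n →₀ ℕ // c.degree ≤ m})]
  congr 1
  ext c c'
  simp [twistMatrix, twistedMonomial_X_pow, coeff_monomial, Matrix.one_apply, Subtype.ext_iff,
    eq_comm]

/-- A real polynomial system `y i ^ D + t * f i = 0`, with `D` odd and `f i` of degree at most `D`,
has a real solution for arbitrarily large `t`. -/
theorem exists_pow_add_mul_eval_eq_zero {D : ℕ} (hD : Odd D)
    (f : Fin n → MvPolynomial (Fin n) ℝ) (hf : ∀ i, (f i).totalDegree ≤ D) (T : ℝ) :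
    ∃ t > T, ∃ y : Fin n → ℝ, ∀ i, y i ^ D + t * eval y (f i) = 0 := by
  let F : ℝ → Fin n → MvPolynomial (Fin n) ℝ := fun t i => X i ^ D + C t * f i
  let G : Fin n → MvPolynomial (Fin n) (Polynomial ℝ) := fun i =>
    X i ^ D + C Polynomial.X * map Polynomial.C (f i)
  have hG : ∀ t i, map (Polynomial.evalRingHom t) (G i) = F t i := by
    intro t i
    have : (Polynomial.evalRingHom t).comp Polynomial.C = RingHom.id ℝ := by
      ext
      simp
    simp [G, F, map_map, this, MvPolynomial.map_id]
  have hdet : ∀ t m, (twistMatrix D (F t) m).det = (twistMatrix D G m).det.eval t := by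
    intro t m
    rw [← Polynomial.coe_evalRingHom, ← det_twistMatrix_map]
    simp only [hG]
  have hne : ∀ m, (twistMatrix D G m).det ≠ 0 := by
    intro m h
    have h0 := hdet 0 m
    have hF0 : F 0 = fun i => (X i : MvPolynomial (Fin n) ℝ) ^ D := by
      ext1 i
      simp [F]
    rw [h, hF0, det_twistMatrix_X_pow] at h0
    simp at h0
  have hcount : (⋃ m, {t | (twistMatrix D G m).det.IsRoot t}).Countable :=
    Set.countable_iUnion fun m => (Polynomial.finite_setOfPred_isRoot (hne m)).countable
  obtain ⟨t, ht, htT⟩ := (hcount.dense_compl ℝ).exists_gt T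
  refine ⟨t, htT, ?_⟩
  have hbij : Function.Bijective (twist D (F t)) := by
    refine twist_bijective (fun i => ?_) fun m => ?_
    · refine (totalDegree_add _ _).trans (max_le (totalDegree_X_pow i D).le ?_)
      refine (totalDegree_mul _ _).trans ?_
      simpa using hf i
    · intro h
      rw [hdet] at h
      exact ht (Set.mem_iUnion.mpr ⟨m, h⟩)
  obtain ⟨φ⟩ := nonempty_algHom_real_of_odd_finrank
    (by rw [finrank_quotient_of_twist_bijective hD.pos hbij]; exact hD.pow)
  let χ := φ.comp (Ideal.Quotient.mkₐ ℝ (Ideal.span (Set.range (F t))))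
  refine ⟨fun i => χ (X i), fun i => ?_⟩
  have hχ : χ (F t i) = 0 := by
    have : Ideal.Quotient.mkₐ ℝ (Ideal.span (Set.range (F t))) (F t i) = 0 :=
      Ideal.Quotient.eq_zero_iff_mem.mpr (Ideal.subset_span ⟨i, rfl⟩)
    rw [AlgHom.comp_apply, this, map_zero]
  have heval : ∀ p, χ p = eval (fun i => χ (X i)) p := by
    intro p
    rw [← MvPolynomial.coe_aeval_eq_eval, RingHom.coe_coe]
    exact DFunLike.congr_fun (MvPolynomial.aeval_unique χ) p
  rw [heval] at hχ
  simpa [F] using hχ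

theorem totalDegree_aeval_le {σ τ : Type*} (g : σ → MvPolynomial τ R)
    (hg : ∀ i, (g i).totalDegree ≤ 1) (p : MvPolynomial σ R) :
    (aeval g p).totalDegree ≤ p.totalDegree := by
  rw [aeval_def, eval₂_eq]
  refine totalDegree_finsetSum_le fun c hc => ?_
  refine (totalDegree_mul _ _).trans ?_
  rw [algebraMap_eq, totalDegree_C, zero_add]
  refine (totalDegree_finsetProd _ _).trans (le_trans ?_ (le_totalDegree hc))
  refine Finset.sum_le_sum fun i _ => (totalDegree_pow _ _).trans ?_
  exact (Nat.mul_le_mul_left _ (hg i)).trans (mul_one _).le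

end Division

section BorsukUlam

open MvPolynomial Metric

theorem MvPolynomial.IsHomogeneous.eval_smul {R σ : Type*} [CommSemiring R] {p : MvPolynomial σ R}
    {m : ℕ} (hp : p.IsHomogeneous m) (r : R) (x : σ → R) :
    eval (r • x) p = r ^ m * eval x p := by
  rw [eval_eq, eval_eq, Finset.mul_sum]
  refine Finset.sum_congr rfl fun c hc => ?_
  simp only [Pi.smul_apply, smul_eq_mul, mul_pow, Finset.prod_mul_distrib,
    Finset.prod_pow_eq_pow_sum, ← hp.degree_eq_sum_deg_support hc]
  ring

/-- On the unit sphere, the odd part of a polynomial agrees with a form of any large odd degree. -/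
theorem exists_isHomogeneous_eval_eq_odd_part {ι : Type*} [Fintype ι] (p : MvPolynomial ι ℝ)
    {D : ℕ} (hD : Odd D) (hpD : p.totalDegree ≤ D) :
    ∃ f : MvPolynomial ι ℝ, f.IsHomogeneous D ∧ ∀ x : ι → ℝ, ∑ i, x i ^ 2 = 1 →
      eval x f = (eval x p - eval (-x) p) / 2 := by
  let s := (Finset.range (p.totalDegree + 1)).filter Odd
  have hs : ∀ j ∈ s, j ≤ p.totalDegree ∧ Odd j := by
    intro j hj
    simpa [s, Nat.lt_succ_iff] using hj
  have hQ : (∑ i, (X i : MvPolynomial ι ℝ) ^ 2).IsHomogeneous 2 :=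
    IsHomogeneous.sum _ _ _ fun i _ => isHomogeneous_X_pow i 2
  refine ⟨∑ j ∈ s, homogeneousComponent j p * (∑ i, X i ^ 2) ^ ((D - j) / 2), ?_, ?_⟩
  · refine IsHomogeneous.sum _ _ _ fun j hj => ?_
    have hjD := hs j hj
    have h := (homogeneousComponent_isHomogeneous j p).mul (hQ.pow ((D - j) / 2))
    rwa [show j + 2 * ((D - j) / 2) = D by grind] at h
  · intro x hx
    have hneg : ∀ j, eval (-x) (homogeneousComponent j p) =
        (-1) ^ j * eval x (homogeneousComponent j p) := by
      intro j
      have h := (homogeneousComponent_isHomogeneous j p).eval_smul (-1 : ℝ) x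
      simpa using h
    have hp : ∀ z, eval z p =
        ∑ j ∈ Finset.range (p.totalDegree + 1), eval z (homogeneousComponent j p) := by
      intro z
      rw [← map_sum, sum_homogeneousComponent]
    rw [hp x, hp (-x), ← Finset.sum_sub_distrib, Finset.sum_div, map_sum, Finset.sum_filter]
    refine Finset.sum_congr rfl fun j _ => ?_
    rw [hneg]
    split_ifs with hj
    · simp [hx, hj.neg_one_pow]
    · simp [(Nat.not_odd_iff_even.mp hj).neg_one_pow]

/-- Stone–Weierstrass on the unit sphere. -/
theorem exists_mvPolynomial_near_sphere {ι : Type*} [Fintype ι]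
    (h : C(sphere (0 : EuclideanSpace ℝ ι) 1, ℝ)) {ε : ℝ} (hε : 0 < ε) :
    ∃ p : MvPolynomial ι ℝ, ∀ x : sphere (0 : EuclideanSpace ℝ ι) 1,
      |eval (fun i => x.1 i) p - h x| < ε := by
  let coord : ι → C(sphere (0 : EuclideanSpace ℝ ι) 1, ℝ) := fun i =>
    ⟨fun x => x.1 i, by fun_prop⟩
  let φ : MvPolynomial ι ℝ →ₐ[ℝ] C(sphere (0 : EuclideanSpace ℝ ι) 1, ℝ) := aeval coord
  have hφ : ∀ p x, φ p x = eval (fun i => x.1 i) p := by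
    intro p x
    induction p using MvPolynomial.induction_on with
    | C a => simp [φ]
    | add p q hp hq => simp [hp, hq]
    | mul_X p i hp => simp [hp, φ, coord]
  have hsep : φ.range.SeparatesPoints := by
    intro x y hxy
    have : ∃ i, x.1 i ≠ y.1 i := by
      by_contra! hall
      exact hxy (Subtype.ext (PiLp.ext hall))
    obtain ⟨i, hi⟩ := this
    exact ⟨φ (X i), ⟨φ (X i), ⟨X i, rfl⟩, rfl⟩, by simpa [hφ] using hi⟩
  obtain ⟨⟨_, p, rfl⟩, hp⟩ :=
    ContinuousMap.exists_mem_subalgebra_near_continuous_of_separatesPoints φ.range hsep h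
      h.continuous ε hε
  refine ⟨p, fun x => ?_⟩
  rw [← hφ]
  exact hp x

/-- The Borsuk–Ulam theorem: an odd map from the `n`-sphere to `ℝⁿ` has a zero. -/
theorem borsukUlam {n : ℕ} (h : Fin n → C(sphere (0 : EuclideanSpace ℝ (Fin (n + 1))) 1, ℝ))
    (hodd : ∀ i x, h i (-x) = -h i x) : ∃ x, ∀ i, h i x = 0 := by
  by_contra! hne
  let H : sphere (0 : EuclideanSpace ℝ (Fin (n + 1))) 1 → Fin n → ℝ := fun x i => h i x
  have hH : Continuous H := by fun_prop
  have : Nonempty (sphere (0 : EuclideanSpace ℝ (Fin (n + 1))) 1) :=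
    (NormedSpace.sphere_nonempty.mpr zero_le_one).to_subtype
  obtain ⟨x₀, -, hx₀⟩ := isCompact_univ.exists_isMinOn Set.univ_nonempty hH.norm.continuousOn
  set ε := ‖H x₀‖ with hε_def
  have hε : 0 < ε := by
    obtain ⟨i, hi⟩ := hne x₀
    exact (norm_pos_iff.mpr hi).trans_le (norm_le_pi_norm (H x₀) i)
  choose p hp using fun i => exists_mvPolynomial_near_sphere (h i) (half_pos hε)
  let D := 2 * (∑ i, (p i).totalDegree) + 1
  have hD : Odd D := ⟨_, rfl⟩
  have hpD : ∀ i, (p i).totalDegree ≤ D := by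
    intro i
    have := Finset.single_le_sum (f := fun i => (p i).totalDegree) (fun _ _ => Nat.zero_le _)
      (Finset.mem_univ i)
    omega
  choose f hfD hf using fun i => exists_isHomogeneous_eval_eq_odd_part (p i) hD (hpD i)
  let g : Fin (n + 1) → MvPolynomial (Fin n) ℝ := Fin.cons 1 X
  have hg : ∀ i, (g i).totalDegree ≤ 1 := by
    intro i
    refine Fin.cases ?_ (fun j => ?_) i
    · simp [g]
    · simp [g]
  obtain ⟨t, ht, y, hy⟩ := exists_pow_add_mul_eval_eq_zero hD (fun i => aeval g (f i))
    (fun i => (totalDegree_aeval_le g hg (f i)).trans (hfD i).totalDegree_le) (2 / ε)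
  let z : EuclideanSpace ℝ (Fin (n + 1)) := WithLp.toLp 2 (Fin.cons 1 y)
  have hz : 0 < ‖z‖ := by
    rw [norm_pos_iff]
    intro h0
    have : z 0 = 0 := by rw [h0]; rfl
    simp [z] at this
  let x : sphere (0 : EuclideanSpace ℝ (Fin (n + 1))) 1 := ⟨‖z‖⁻¹ • z, by simp [norm_smul, hz.ne']⟩
  have hxz : ∀ i, z i = ‖z‖ * x.1 i := by
    intro i
    simp [x, hz.ne']
  have hxsum : ∑ i, x.1 i ^ 2 = 1 := by
    have := EuclideanSpace.real_norm_sq_eq x.1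
    rw [← this, norm_eq_of_mem_sphere]
    norm_num
  have hgz : ∀ i, eval y (aeval g (f i)) = ‖z‖ ^ D * eval (fun j => x.1 j) (f i) := by
    intro i
    have h1 : eval y (aeval g (f i)) = eval (fun j => z j) (f i) := by
      rw [← MvPolynomial.coe_aeval_eq_eval, RingHom.coe_coe, ← AlgHom.comp_apply, comp_aeval,
        ← MvPolynomial.coe_aeval_eq_eval, RingHom.coe_coe]
      congr 2
      ext j
      refine Fin.cases ?_ (fun j => ?_) j
      · simp [g, z]
      · simp [g, z]
    rw [h1, ← (hfD i).eval_smul]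
    congr 2
    ext j
    exact hxz j
  have hlt : ‖H x‖ < ε := by
    rw [pi_norm_lt_iff hε]
    intro i
    have hfx := hf i (fun j => x.1 j) hxsum
    have hpx := hp i x
    have hpnx := hp i (-x)
    rw [hodd] at hpnx
    have hneg : (fun j => (-x).1 j) = -(fun j => x.1 j) := by
      ext j
      simp
    rw [hneg] at hpnx
    have hyi := hy i
    have hyz : y i = ‖z‖ * x.1 i.succ := by
      rw [← hxz]
      simp [z]
    rw [hgz, hyz, mul_pow, ← mul_assoc, mul_comm t, mul_assoc, ← mul_add,
      mul_eq_zero, or_iff_right (pow_pos hz D).ne'] at hyi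
    have hx1 : |x.1 i.succ| ≤ 1 := by
      have := PiLp.norm_apply_le x.1 i.succ
      rwa [norm_eq_of_mem_sphere, Real.norm_eq_abs] at this
    have hxD : |x.1 i.succ ^ D| ≤ 1 := by
      rw [abs_pow]
      exact pow_le_one₀ (abs_nonneg _) hx1
    set e := eval (fun j => x.1 j) (f i)
    have htε : 2 < t * ε := (div_lt_iff₀ hε).mp ht
    have ht0 : 0 < t := (by positivity : 0 < 2 / ε).trans ht
    have he : |e| < ε / 2 := by
      have : t * |e| ≤ 1 := by
        rw [← abs_of_pos ht0, ← abs_mul, show t * e = -(x.1 i.succ ^ D) by linarith, abs_neg]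
        exact hxD
      by_contra! hcon
      nlinarith
    rw [Real.norm_eq_abs]
    change |h i x| < ε
    rw [abs_lt] at *
    constructor <;> linarith
  exact absurd (hx₀ (Set.mem_univ x)) (not_le.mpr hlt)

/-- If `n + 2` antipode-free open sets cover the `n`-sphere, then all of them but the first have a
common point. -/
theorem exists_forall_ne_zero_mem_of_antipodeFree_cover {n : ℕ}
    (U : Fin (n + 2) → Set (sphere (0 : EuclideanSpace ℝ (Fin (n + 1))) 1))
    (hopen : ∀ i, IsOpen (U i)) (hcover : ∀ x, ∃ i, x ∈ U i)
    (hfree : ∀ i, ∀ x ∈ U i, -x ∉ U i) : ∃ x, ∀ i ≠ 0, x ∈ U i := by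
  let f : Fin (n + 2) → C(sphere (0 : EuclideanSpace ℝ (Fin (n + 1))) 1, ℝ) := fun i =>
    ⟨fun x => infDist x (U i)ᶜ, continuous_infDist_pt _⟩
  have hf0 : ∀ i x, 0 ≤ f i x := fun i x => infDist_nonneg
  have hfpos : ∀ i x, 0 < f i x ↔ x ∈ U i := by
    intro i x
    have hne : (U i)ᶜ.Nonempty := by
      by_cases hx : x ∈ U i
      · exact ⟨-x, hfree i x hx⟩
      · exact ⟨x, hx⟩
    have := (hopen i).isClosed_compl.notMem_iff_infDist_pos hne (x := x)
    rw [Set.notMem_compl_iff] at this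
    exact this.symm
  let w : C(sphere (0 : EuclideanSpace ℝ (Fin (n + 1))) 1, ℝ) := ∑ i, f i
  have hw : ∀ x, w x = ∑ i, f i x := fun x => by simp [w]
  have hw0 : ∀ x, 0 < w x := by
    intro x
    obtain ⟨i, hi⟩ := hcover x
    rw [hw]
    exact Finset.sum_pos' (fun j _ => hf0 j x) ⟨i, Finset.mem_univ i, (hfpos i x).mpr hi⟩
  let g : Fin (n + 2) → C(sphere (0 : EuclideanSpace ℝ (Fin (n + 1))) 1, ℝ) := fun i =>
    ⟨fun x => w (-x) * f i x - w x * f i (-x), by fun_prop⟩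
  have hg : ∀ i x, g i x = w (-x) * f i x - w x * f i (-x) := fun _ _ => rfl
  have hgodd : ∀ i x, g i (-x) = -g i x := by
    intro i x
    rw [hg, hg, neg_neg]
    ring
  have hgsum : ∀ x, ∑ i, g i x = 0 := by
    intro x
    simp only [hg, Finset.sum_sub_distrib, ← Finset.mul_sum, ← hw]
    ring
  have hgmem : ∀ i x, 0 < g i x → x ∈ U i := by
    intro i x hpos
    rw [← hfpos]
    rw [hg] at hpos
    have := mul_nonneg (hw0 x).le (hf0 i (-x))
    exact pos_of_mul_pos_right (by linarith) (hw0 (-x)).le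
  obtain ⟨x, hx⟩ := borsukUlam (fun j : Fin n => g j.succ.succ - g 1) (by
    intro i x
    simp only [ContinuousMap.sub_apply, hgodd]
    ring)
  have hc : ∀ i ≠ 0, g i x = g 1 x := by
    intro i hi
    obtain ⟨j, rfl⟩ := Fin.exists_succ_eq.mpr hi
    refine Fin.cases rfl (fun l => ?_) j
    exact sub_eq_zero.mp (hx l)
  rcases lt_trichotomy (g 1 x) 0 with hneg | hzero | hpos
  · refine ⟨-x, fun i hi => hgmem i _ ?_⟩
    rw [hgodd, hc i hi]
    linarith
  · exfalso
    have hall : ∀ i, g i x = 0 := by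
      intro i
      by_cases hi : i = 0
      · have := hgsum x
        rwa [Finset.sum_eq_single 0 (fun j _ hj => (hc j hj).trans hzero) (by simp), ← hi] at this
      · exact (hc i hi).trans hzero
    obtain ⟨i, hi⟩ := hcover x
    have h1 := (hfpos i x).mpr hi
    have h2 : f i (-x) = 0 :=
      le_antisymm (not_lt.mp fun h => hfree i x hi ((hfpos i _).mp h)) (hf0 i _)
    have h3 := hall i
    rw [hg, h2, mul_zero, sub_zero] at h3
    exact (mul_pos (hw0 (-x)) h1).ne' h3
  · exact ⟨x, fun i hi => hgmem i x (by rwa [hc i hi])⟩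

end BorsukUlam

/-- For `k ≥ 2`, the sphere `S^{2k}` (the unit sphere in `ℝ^{2k+1}`) cannot be
covered by `2k+2` open sets, none containing a pair of antipodal points, such that
every point of the sphere is contained in at most `k+2` of the sets. -/
theorem even_sphere_no_small_cover (k : ℕ) (hk : 2 ≤ k) :
    ¬ ∃ U : Fin (2 * k + 2) → Set (EuclideanSpace ℝ (Fin (2 * k + 1))),
      (∀ i, ∃ V, IsOpen V ∧ U i = V ∩ Metric.sphere 0 1) ∧
      (Metric.sphere (0 : EuclideanSpace ℝ (Fin (2 * k + 1))) 1 ⊆ ⋃ i, U i) ∧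
      (∀ i, ∀ x, x ∈ U i → -x ∉ U i) ∧
      (∀ x ∈ Metric.sphere (0 : EuclideanSpace ℝ (Fin (2 * k + 1))) 1,
        {i : Fin (2 * k + 2) | x ∈ U i}.ncard ≤ k + 2) := by
  rintro ⟨U, hopen, hcover, hfree, hmult⟩
  obtain ⟨x, hx⟩ := exists_forall_ne_zero_mem_of_antipodeFree_cover (n := 2 * k)
    (fun i => Subtype.val ⁻¹' U i)
    (fun i => by
      obtain ⟨V, hV, hUV⟩ := hopen i
      convert hV.preimage continuous_subtype_val using 1
      ext y
      simp [hUV])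
    (fun x => by simpa using hcover x.2)
    (fun i x hxU => hfree i x hxU)
  have hsub : ({0}ᶜ : Set (Fin (2 * k + 2))) ⊆ {i | x.1 ∈ U i} := fun i hi => hx i hi
  have hle := (Set.ncard_le_ncard hsub).trans (hmult x x.2)
  rw [Set.ncard_compl, Set.ncard_singleton, Nat.card_eq_fintype_card, Fintype.card_fin] at hle
  omega
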